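/- There is no finite sequence Δ₀, Δ₁, ..., Δ_{t−1} of triangles in ℝ², such that the intersection of any two of them is a common face of both, satisfying the cyclic chain Δ₀ ≺ Δ₁ ≺ ⋯ ≺ Δ_{t−1} ≺ Δ₀. -/

import Mathlib

open Set

noncomputable section

/-- A point of the integer lattice `ℤ² ⊆ ℝ²`. -/
def IsLatticePoint (p : ℝ × ℝ) : Prop := ∃ a b : ℤ, p = ((a : ℝ), (b : ℝ))

/-- A triangle: the convex hull of three affinely independent points of `ℝ²`. -/
def IsTriangle (Δ : Set (ℝ × ℝ)) : Prop :=
  ∃ p q r : ℝ × ℝ, AffineIndependent ℝ ![p, q, r] ∧ Δ = convexHull ℝ {p, q, r}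

/-- `F` is a face of the triangle `Δ`: the empty set, a vertex, an edge,
or the whole triangle. -/
def IsFaceOf (F Δ : Set (ℝ × ℝ)) : Prop :=
  ∃ p q r : ℝ × ℝ, AffineIndependent ℝ ![p, q, r] ∧ Δ = convexHull ℝ {p, q, r} ∧
    (F = ∅ ∨ F = {p} ∨ F = {q} ∨ F = {r} ∨
     F = segment ℝ p q ∨ F = segment ℝ q r ∨ F = segment ℝ p r ∨ F = Δ)

/-- The determinant of the two edge vectors of the triangle `pqr` emanating
from `p`; its absolute value is twice the Euclidean area of the triangle. -/
def triDet (p q r : ℝ × ℝ) : ℝ :=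
  (q.1 - p.1) * (r.2 - p.2) - (q.2 - p.2) * (r.1 - p.1)

/-- A unimodular triangle: a lattice triangle of area `1/2`. -/
def IsUnimodularTriangle (Δ : Set (ℝ × ℝ)) : Prop :=
  ∃ p q r : ℝ × ℝ, IsLatticePoint p ∧ IsLatticePoint q ∧ IsLatticePoint r ∧
    AffineIndependent ℝ ![p, q, r] ∧ Δ = convexHull ℝ {p, q, r} ∧
    |triDet p q r| = 1

/-- `T` is a unimodular triangulation of the region `P`. -/
def IsUnimodularTriangulation (P : Set (ℝ × ℝ)) (T : Set (Set (ℝ × ℝ))) : Prop :=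
  T.Finite ∧ (∀ Δ ∈ T, IsUnimodularTriangle Δ ∧ Δ ⊆ P) ∧ ⋃₀ T = P ∧
  ∀ Δ₁ ∈ T, ∀ Δ₂ ∈ T, IsFaceOf (Δ₁ ∩ Δ₂) Δ₁ ∧ IsFaceOf (Δ₁ ∩ Δ₂) Δ₂

/-- The number of unimodular triangulations of the region `P`. -/
def numTriangulations (P : Set (ℝ × ℝ)) : ℕ :=
  Set.ncard {T | IsUnimodularTriangulation P T}

/-- `f m n` is the number of unimodular triangulations of `[0,m] × [0,n]`. -/
def f (m n : ℕ) : ℕ :=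
  numTriangulations (Set.Icc (0, 0) ((m : ℝ), (n : ℝ)))

/-- `Δ₂` lies above `Δ₁` (written `Δ₁ ≺ Δ₂`). -/
def LiesAbove (Δ₁ Δ₂ : Set (ℝ × ℝ)) : Prop :=
  ∃ x y₁ y₂ : ℝ, (x, y₁) ∈ Δ₁ \ Δ₂ ∧ (x, y₂) ∈ Δ₂ \ Δ₁ ∧ y₁ < y₂

/-- `A` is weakly below `B` on every vertical line meeting both, and strictly somewhere. -/
def StrictlyBelow (A B : Set (ℝ × ℝ)) : Prop :=
  (∀ x a b, (x, a) ∈ A → (x, b) ∈ B → a ≤ b) ∧ ∃ x a b, (x, a) ∈ A ∧ (x, b) ∈ B ∧ a < b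

/-- Some line has `A` on one side and `B` on the other. -/
def LineSeparated (A B : Set (ℝ × ℝ)) : Prop :=
  ∃ α β u : ℝ, (α ≠ 0 ∨ β ≠ 0) ∧ (∀ z ∈ A, α * z.1 + β * z.2 ≤ u) ∧
    ∀ z ∈ B, u ≤ α * z.1 + β * z.2

theorem LineSeparated.strictlyBelow {A B : Set (ℝ × ℝ)} (h : LineSeparated A B) {x a b : ℝ}
    (ha : (x, a) ∈ A) (hb : (x, b) ∈ B) (hab : a < b)
    (hx : ∀ a b, (x, a) ∈ A → (x, b) ∈ B → a ≤ b) : StrictlyBelow A B := by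
  refine ⟨fun x' a' b' ha' hb' => ?_, x, a, b, ha, hb, hab⟩
  obtain ⟨α, β, u, hne, hA, hB⟩ := h
  have h1 := hA _ ha
  have h2 := hB _ hb
  have h3 := hA _ ha'
  have h4 := hB _ hb'
  simp only at h1 h2 h3 h4
  rcases eq_or_ne β 0 with rfl | hβ
  · have hα : α ≠ 0 := by simpa using hne
    have : α * x' = α * x := by linarith
    obtain rfl := mul_left_cancel₀ hα this
    exact hx _ _ ha' hb'
  · have hβ' : 0 < β := by
      refine lt_of_le_of_ne ?_ hβ.symm
      by_contra! hneg
      nlinarith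
    by_contra! hlt
    nlinarith

theorem Convex.exists_mem_slice {A : Set (ℝ × ℝ)} (hA : Convex ℝ A) {p q : ℝ × ℝ}
    (hp : p ∈ A) (hq : q ∈ A) {x : ℝ} (h1 : p.1 ≤ x) (h2 : x ≤ q.1) : ∃ y, (x, y) ∈ A := by
  have hc := hA.linear_image (LinearMap.fst ℝ ℝ ℝ)
  obtain ⟨z, hz, rfl⟩ := hc.ordConnected.out ⟨p, hp, rfl⟩ ⟨q, hq, rfl⟩ ⟨h1, h2⟩
  exact ⟨z.2, hz⟩

theorem Convex.slice_mem {A : Set (ℝ × ℝ)} (hA : Convex ℝ A) {x y₁ y₂ y : ℝ}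
    (h₁ : (x, y₁) ∈ A) (h₂ : (x, y₂) ∈ A) (h : y₁ ≤ y) (h' : y ≤ y₂) : (x, y) ∈ A := by
  have hc : Convex ℝ {y | (x, y) ∈ A} := by
    intro u hu v hv a b ha hb hab
    have := hA hu hv ha hb hab
    simpa [← add_mul, hab] using this
  exact hc.ordConnected.out h₁ h₂ ⟨h, h'⟩

theorem exists_lt_mem_of_mem_interior {C : Set (ℝ × ℝ)} {z : ℝ × ℝ} (hz : z ∈ interior C) :
    ∃ y, z.2 < y ∧ (z.1, y) ∈ C := by
  have hev : ∀ᶠ y in nhds z.2, (z.1, y) ∈ C := by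
    have hc : Continuous fun y : ℝ => (z.1, y) := by fun_prop
    exact hc.continuousAt.eventually (mem_interior_iff_mem_nhds.1 hz)
  obtain ⟨y, hy, hlt⟩ := ((hev.filter_mono nhdsWithin_le_nhds).and
    (self_mem_nhdsWithin (s := Set.Ioi z.2))).exists
  exact ⟨y, hlt, hy⟩

theorem Convex.exists_lt_mem_slice {C : Set (ℝ × ℝ)} (hC : Convex ℝ C)
    (hi : (interior C).Nonempty) {p q : ℝ × ℝ} (hp : p ∈ C) (hq : q ∈ C) {x : ℝ}
    (h1 : p.1 < x) (h2 : x < q.1) : ∃ c d, c < d ∧ (x, c) ∈ C ∧ (x, d) ∈ C := by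
  obtain ⟨z, hz⟩ := hi
  have key : ∃ w ∈ interior C, w.1 = x := by
    have aux : ∀ r ∈ C, ∀ t : ℝ, 0 < t → t ≤ 1 → r + t • (z - r) ∈ interior C :=
      fun r hr t h0 h1 => hC.add_smul_sub_mem_interior hr hz ⟨h0, h1⟩
    rcases le_total z.1 x with h | h
    · refine ⟨_, aux q hq ((q.1 - x) / (q.1 - z.1)) (div_pos (by linarith) (by linarith))
        ((div_le_one (by linarith)).2 (by linarith)), ?_⟩
      have : q.1 - z.1 ≠ 0 := by linarith
      simp only [Prod.fst_add, Prod.smul_fst, Prod.fst_sub, smul_eq_mul]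
      field_simp
      ring
    · refine ⟨_, aux p hp ((x - p.1) / (z.1 - p.1)) (div_pos (by linarith) (by linarith))
        ((div_le_one (by linarith)).2 (by linarith)), ?_⟩
      have : z.1 - p.1 ≠ 0 := by linarith
      simp only [Prod.fst_add, Prod.smul_fst, Prod.fst_sub, smul_eq_mul]
      field_simp
      ring
  obtain ⟨w, hw, rfl⟩ := key
  obtain ⟨y, hy, hyC⟩ := exists_lt_mem_of_mem_interior hw
  exact ⟨w.2, y, hy, interior_subset hw, hyC⟩

/-- Strict comparison passes through a set `C` whose right end is leftmost. -/
theorem StrictlyBelow.exists_slice {A B C : Set (ℝ × ℝ)} (hA : Convex ℝ A) (hB : Convex ℝ B)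
    (hC : Convex ℝ C) (hi : (interior C).Nonempty) (hAC : StrictlyBelow A C)
    (hCB : StrictlyBelow C B) {p q r : ℝ × ℝ} (hr : r ∈ C) (hmax : ∀ z ∈ C, z.1 ≤ r.1)
    (hp : p ∈ A) (hpr : r.1 ≤ p.1) (hq : q ∈ B) (hqr : r.1 ≤ q.1) :
    ∃ x a b, (x, a) ∈ A ∧ (x, b) ∈ B ∧ a < b ∧
      ∀ a b, (x, a) ∈ A → (x, b) ∈ B → a ≤ b := by
  obtain ⟨hAC, x₁, a₁, c₁, ha₁, hc₁, hlt₁⟩ := hAC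
  obtain ⟨hCB, x₂, c₂, b₂, hc₂, hb₂, hlt₂⟩ := hCB
  have hx₁ : x₁ ≤ r.1 := hmax _ hc₁
  have hx₂ : x₂ ≤ r.1 := hmax _ hc₂
  obtain ⟨a, ha⟩ := hA.exists_mem_slice ha₁ hp hx₁ hpr
  obtain ⟨b, hb⟩ := hB.exists_mem_slice hb₂ hq hx₂ hqr
  have hle : ∀ a b, (r.1, a) ∈ A → (r.1, b) ∈ B → a ≤ b := fun a b ha hb =>
    (hAC _ _ r.2 ha hr).trans (hCB _ _ _ hr hb)
  by_cases hs : ∃ a b, (r.1, a) ∈ A ∧ (r.1, b) ∈ B ∧ a < b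
  · obtain ⟨a, b, ha, hb, hab⟩ := hs
    exact ⟨r.1, a, b, ha, hb, hab, hle⟩
  push Not at hs
  have hx₁' : x₁ < r.1 := by
    refine lt_of_le_of_ne hx₁ ?_
    rintro rfl
    have := hs _ _ ha₁ hb
    have := hCB _ _ _ hc₁ hb
    linarith
  have hx₂' : x₂ < r.1 := by
    refine lt_of_le_of_ne hx₂ ?_
    rintro rfl
    have := hs _ _ ha hb₂
    have := hAC _ _ _ ha hc₂
    linarith
  obtain ⟨x, hx, hxr⟩ := exists_between (max_lt hx₁' hx₂')
  have h₁ : x₁ < x := (le_max_left _ _).trans_lt hx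
  have h₂ : x₂ < x := (le_max_right _ _).trans_lt hx
  obtain ⟨c, d, hcd, hc, hd⟩ := hC.exists_lt_mem_slice hi hc₁ hr h₁ hxr
  obtain ⟨a', ha'⟩ := hA.exists_mem_slice ha₁ ha h₁.le hxr.le
  obtain ⟨b', hb'⟩ := hB.exists_mem_slice hb₂ hb h₂.le hxr.le
  exact ⟨x, a', b', ha', hb', (hAC _ _ _ ha' hc).trans_lt (hcd.trans_le (hCB _ _ _ hd hb')),
    fun _ _ ha hb => (hAC _ _ _ ha hc).trans (hCB _ _ _ hc hb)⟩

theorem StrictlyBelow.ne {A B : Set (ℝ × ℝ)} (h : StrictlyBelow A B) : A ≠ B := by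
  rintro rfl
  obtain ⟨h, x, a, b, ha, hb, hab⟩ := h
  exact absurd (h _ _ _ hb ha) (not_le.2 hab)

/-- A finite nonempty family of pairwise line-separated planar convex bodies has a maximal
element for `StrictlyBelow`. -/
theorem exists_not_strictlyBelow (s : Finset (Set (ℝ × ℝ))) (hs : s.Nonempty)
    (hconv : ∀ A ∈ s, Convex ℝ A) (hcomp : ∀ A ∈ s, IsCompact A)
    (hint : ∀ A ∈ s, (interior A).Nonempty)
    (hsep : ∀ A ∈ s, ∀ B ∈ s, A ≠ B → LineSeparated A B) :
    ∃ A ∈ s, ∀ B ∈ s, ¬ StrictlyBelow A B := by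
  classical
  induction hn : s.card generalizing s with
  | zero => simp_all
  | succ n ih =>
    by_contra! hsucc
    have hend : ∀ A : Set (ℝ × ℝ), ∃ r : ℝ × ℝ, A ∈ s → r ∈ A ∧ ∀ z ∈ A, z.1 ≤ r.1 := by
      intro A
      by_cases hA : A ∈ s
      · obtain ⟨r, hr, hmax⟩ := (hcomp A hA).exists_isMaxOn
          ((hint A hA).mono interior_subset) continuous_fst.continuousOn
        exact ⟨r, fun _ => ⟨hr, fun z hz => hmax hz⟩⟩
      · exact ⟨0, fun h => absurd h hA⟩
    choose r hr using hend
    obtain ⟨C, hC, hmin⟩ := s.exists_min_image (fun A => (r A).1) hs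
    obtain ⟨B, hB, hCB⟩ := hsucc C hC
    have hBC : B ∈ s.erase C := Finset.mem_erase.2 ⟨hCB.ne.symm, hB⟩
    have hsub : ∀ A ∈ s.erase C, A ∈ s := fun A hA => Finset.mem_of_mem_erase hA
    obtain ⟨A, hA, hmaxA⟩ := ih (s.erase C) ⟨B, hBC⟩ (fun A hA => hconv A (hsub A hA))
      (fun A hA => hcomp A (hsub A hA)) (fun A hA => hint A (hsub A hA))
      (fun A hA B hB => hsep A (hsub A hA) B (hsub B hB))
      (by rw [Finset.card_erase_of_mem hC, hn]; rfl)
    obtain ⟨D, hD, hAD⟩ := hsucc A (hsub A hA)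
    by_cases hDC : D = C
    · subst hDC
      obtain ⟨x, a, b, ha, hb, hab, hle⟩ := hAD.exists_slice (hconv A (hsub A hA)) (hconv B hB)
        (hconv D hD) (hint D hD) hCB (hr D hD).1 (hr D hD).2 (hr A (hsub A hA)).1
        (hmin A (hsub A hA)) (hr B hB).1 (hmin B hB)
      have hne : A ≠ B := by
        rintro rfl
        exact absurd (hle _ _ hb ha) (not_le.2 hab)
      exact hmaxA B hBC ((hsep A (hsub A hA) B hB hne).strictlyBelow ha hb hab hle)
    · exact hmaxA D (Finset.mem_erase.2 ⟨hDC, hD⟩) hAD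

theorem Convex.lineSeparated {A B : Set (ℝ × ℝ)} (hA : Convex ℝ A) (hB : Convex ℝ B)
    (hiA : (interior A).Nonempty) (hiB : (interior B).Nonempty)
    (hd : Disjoint (interior A) (interior B)) : LineSeparated A B := by
  obtain ⟨φ, u, hφA, hφB⟩ := geometric_hahn_banach_open_open hA.interior isOpen_interior
    hB.interior isOpen_interior hd
  have hφ : ∀ z : ℝ × ℝ, φ z = φ (1, 0) * z.1 + φ (0, 1) * z.2 := by
    intro z
    have : z = z.1 • ((1 : ℝ), (0 : ℝ)) + z.2 • ((0 : ℝ), (1 : ℝ)) := by ext <;> simp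
    conv_lhs => rw [this]
    simp only [map_add, map_smul, smul_eq_mul]
    ring
  refine ⟨φ (1, 0), φ (0, 1), u, ?_, fun z hz => ?_, fun z hz => ?_⟩
  · by_contra! h
    obtain ⟨a, ha⟩ := hiA
    obtain ⟨b, hb⟩ := hiB
    have h1 := hφA a ha
    have h2 := hφB b hb
    rw [hφ, h.1, h.2] at h1 h2
    linarith
  · rw [← hφ]
    have hz' : z ∈ closure (interior A) := by
      rw [hA.closure_interior_eq_closure_of_nonempty_interior hiA]
      exact subset_closure hz
    exact closure_minimal (fun w hw => (hφA w hw).le)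
      (isClosed_le φ.continuous continuous_const) hz'
  · rw [← hφ]
    have hz' : z ∈ closure (interior B) := by
      rw [hB.closure_interior_eq_closure_of_nonempty_interior hiB]
      exact subset_closure hz
    exact closure_minimal (fun w hw => (hφB w hw).le)
      (isClosed_le continuous_const φ.continuous) hz'

theorem IsTriangle.convex {Δ : Set (ℝ × ℝ)} (h : IsTriangle Δ) : Convex ℝ Δ := by
  obtain ⟨p, q, r, -, rfl⟩ := h
  exact convex_convexHull ℝ _

theorem IsTriangle.isCompact {Δ : Set (ℝ × ℝ)} (h : IsTriangle Δ) : IsCompact Δ := by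
  obtain ⟨p, q, r, -, rfl⟩ := h
  exact (Set.toFinite _).isCompact_convexHull ℝ

theorem IsTriangle.interior_nonempty {Δ : Set (ℝ × ℝ)} (h : IsTriangle Δ) :
    (interior Δ).Nonempty := by
  obtain ⟨p, q, r, hi, rfl⟩ := h
  refine interior_convexHull_nonempty_iff_affineSpan_eq_top.2 ?_
  have := hi.affineSpan_eq_top_iff_card_eq_finrank_add_one.2 (by simp)
  rwa [Matrix.range_cons, Matrix.range_cons, Matrix.range_cons, Matrix.range_empty,
    Set.union_empty, Set.singleton_union, Set.singleton_union] at this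

theorem AffineIndependent.triDet_ne_zero {p q r : ℝ × ℝ}
    (h : AffineIndependent ℝ ![p, q, r]) : triDet p q r ≠ 0 := by
  intro h0
  unfold triDet at h0
  refine affineIndependent_iff_not_collinear_set.1 h ?_
  rcases eq_or_ne p q with rfl | hpq
  · simp [collinear_pair]
  rw [collinear_iff_of_mem (p₀ := p) (by simp)]
  refine ⟨q - p, ?_⟩
  have hn : (q.1 - p.1) ^ 2 + (q.2 - p.2) ^ 2 ≠ 0 := by
    intro hn
    refine hpq (Prod.ext ?_ ?_) <;> nlinarith [sq_nonneg (q.1 - p.1), sq_nonneg (q.2 - p.2)]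
  simp only [mem_insert_iff, mem_singleton_iff, forall_eq_or_imp, forall_eq]
  refine ⟨⟨0, by simp⟩, ⟨1, by simp⟩,
    ((q.1 - p.1) * (r.1 - p.1) + (q.2 - p.2) * (r.2 - p.2)) /
      ((q.1 - p.1) ^ 2 + (q.2 - p.2) ^ 2), ?_⟩
  ext
  · simp only [vadd_eq_add, Prod.fst_add, Prod.smul_fst, Prod.fst_sub, smul_eq_mul]
    field_simp
    linear_combination -(q.2 - p.2) * h0
  · simp only [vadd_eq_add, Prod.snd_add, Prod.smul_snd, Prod.snd_sub, smul_eq_mul]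
    field_simp
    linear_combination (q.1 - p.1) * h0

/-- The affine form `triDet p q` vanishes on the segment `pq`. -/
theorem triDet_eq_zero_of_mem_segment {p q z : ℝ × ℝ} (hz : z ∈ segment ℝ p q) :
    triDet p q z = 0 := by
  obtain ⟨a, b, ha, hb, hab, rfl⟩ := hz
  obtain rfl : a = 1 - b := by linarith
  simp only [triDet, Prod.fst_add, Prod.snd_add, Prod.smul_fst, Prod.smul_snd, smul_eq_mul]
  ring

theorem mem_segment_of_triDet_eq_zero {p q r z : ℝ × ℝ} (h : triDet p q r ≠ 0)
    (hz : z ∈ convexHull ℝ {p, q, r}) (h0 : triDet p q z = 0) : z ∈ segment ℝ p q := by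
  rw [convexHull_insert (by simp), convexHull_pair] at hz
  simp only [mem_convexJoin, mem_singleton_iff, exists_eq_left] at hz
  obtain ⟨w, ⟨a, b, ha, hb, hab, rfl⟩, c, d, hc, hd, hcd, rfl⟩ := hz
  have key : d * b * triDet p q r = 0 := by
    obtain rfl : a = 1 - b := by linarith
    obtain rfl : c = 1 - d := by linarith
    rw [← h0]
    simp only [triDet, Prod.fst_add, Prod.snd_add, Prod.smul_fst, Prod.smul_snd, smul_eq_mul]
    ring
  have hdb : d * b = 0 := by simpa [h] using key
  refine ⟨c, d * a, hc, mul_nonneg hd ha, by linear_combination hcd + d * hab - hdb, ?_⟩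
  rw [smul_add, smul_smul, smul_smul, hdb, zero_smul, add_zero]

/-- A proper face lies in an edge, and is that edge unless it has at most one point. -/
theorem IsFaceOf.eq_or_subset_segment {F Δ : Set (ℝ × ℝ)} (h : IsFaceOf F Δ) :
    F = Δ ∨ ∃ p q r : ℝ × ℝ, triDet p q r ≠ 0 ∧ Δ = convexHull ℝ {p, q, r} ∧
      F ⊆ segment ℝ p q ∧ (F.Subsingleton ∨ F = segment ℝ p q) := by
  obtain ⟨p, q, r, hi, hΔ, hF⟩ := h
  have hd := hi.triDet_ne_zero
  have hqr : triDet q r p ≠ 0 := by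
    rwa [show triDet q r p = triDet p q r by unfold triDet; ring]
  have hpr : triDet p r q ≠ 0 := by
    rw [show triDet p r q = -triDet p q r by unfold triDet; ring]
    exact neg_ne_zero.2 hd
  have hΔqr : Δ = convexHull ℝ {q, r, p} := by
    rw [hΔ, Set.insert_comm, Set.pair_comm p r]
  have hΔpr : Δ = convexHull ℝ {p, r, q} := by rw [hΔ, Set.pair_comm q r]
  rcases hF with rfl | rfl | rfl | rfl | rfl | rfl | rfl | rfl
  · exact .inr ⟨p, q, r, hd, hΔ, empty_subset _, .inl subsingleton_empty⟩
  · exact .inr ⟨p, q, r, hd, hΔ, singleton_subset_iff.2 (left_mem_segment ..),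
      .inl subsingleton_singleton⟩
  · exact .inr ⟨p, q, r, hd, hΔ, singleton_subset_iff.2 (right_mem_segment ..),
      .inl subsingleton_singleton⟩
  · exact .inr ⟨q, r, p, hqr, hΔqr, singleton_subset_iff.2 (right_mem_segment ..),
      .inl subsingleton_singleton⟩
  · exact .inr ⟨p, q, r, hd, hΔ, subset_rfl, .inr rfl⟩
  · exact .inr ⟨q, r, p, hqr, hΔqr, subset_rfl, .inr rfl⟩
  · exact .inr ⟨p, r, q, hpr, hΔpr, subset_rfl, .inr rfl⟩
  · exact .inl rfl

/-- A face with two points on a vertical line contains the whole slice of the triangle. -/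
theorem IsFaceOf.slice_mem {F Δ : Set (ℝ × ℝ)} (h : IsFaceOf F Δ) {x a b y : ℝ}
    (ha : (x, a) ∈ F) (hb : (x, b) ∈ F) (hab : a ≠ b) (hy : (x, y) ∈ Δ) : (x, y) ∈ F := by
  obtain rfl | ⟨p, q, r, hd, rfl, -, hF⟩ := h.eq_or_subset_segment
  · exact hy
  rcases hF with hF | rfl
  · exact absurd (congrArg Prod.snd (hF ha hb)) hab
  refine mem_segment_of_triDet_eq_zero hd hy ?_
  have h1 := triDet_eq_zero_of_mem_segment ha
  have h2 := triDet_eq_zero_of_mem_segment hb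
  simp only [triDet] at h1 h2 ⊢
  have h3 : (q.1 - p.1) * (a - b) = 0 := by linear_combination h1 - h2
  have h4 : q.1 - p.1 = 0 := (mul_eq_zero.1 h3).resolve_right (sub_ne_zero.2 hab)
  linear_combination h1 + (y - a) * h4

theorem interior_segment_eq_empty {p q r : ℝ × ℝ} (h : triDet p q r ≠ 0) :
    interior (segment ℝ p q) = ∅ := by
  rw [Set.eq_empty_iff_forall_notMem]
  intro z hz
  have hev : ∀ᶠ t in nhds (0 : ℝ), z + t • (r - p) ∈ segment ℝ p q := by
    have hc : Continuous fun t : ℝ => z + t • (r - p) := by fun_prop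
    refine hc.continuousAt.eventually ?_
    simpa using mem_interior_iff_mem_nhds.1 hz
  obtain ⟨t, ht, hlt⟩ := ((hev.filter_mono nhdsWithin_le_nhds).and
    (self_mem_nhdsWithin (s := Set.Ioi (0 : ℝ)))).exists
  have h1 := triDet_eq_zero_of_mem_segment ht
  have h2 := triDet_eq_zero_of_mem_segment (interior_subset hz)
  have h3 : t * triDet p q r = 0 := by
    simp only [triDet, Prod.fst_add, Prod.snd_add, Prod.smul_fst, Prod.smul_snd, Prod.fst_sub,
      Prod.snd_sub, smul_eq_mul] at h1 h2 ⊢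
    linear_combination h1 - h2
  exact (mul_ne_zero (ne_of_gt hlt) h) h3

theorem IsFaceOf.interior_eq_empty {F Δ : Set (ℝ × ℝ)} (h : IsFaceOf F Δ) (hne : F ≠ Δ) :
    interior F = ∅ := by
  obtain ⟨p, q, r, hd, -, hF, -⟩ := h.eq_or_subset_segment.resolve_left hne
  exact Set.subset_eq_empty (interior_mono hF) (interior_segment_eq_empty hd)

theorem IsTriangle.lineSeparated {A B : Set (ℝ × ℝ)} (hA : IsTriangle A) (hB : IsTriangle B)
    (h₁ : IsFaceOf (A ∩ B) A) (h₂ : IsFaceOf (A ∩ B) B) (hne : A ≠ B) : LineSeparated A B := by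
  refine hA.convex.lineSeparated hB.convex hA.interior_nonempty hB.interior_nonempty ?_
  rw [Set.disjoint_iff_inter_eq_empty, ← interior_inter]
  by_cases h : A ∩ B = A
  · exact h₂.interior_eq_empty fun h' => hne (h.symm.trans h')
  · exact h₁.interior_eq_empty h

theorem LiesAbove.strictlyBelow {A B : Set (ℝ × ℝ)} (h : LiesAbove A B) (hA : IsTriangle A)
    (hB : IsTriangle B) (h₁ : IsFaceOf (A ∩ B) A) (h₂ : IsFaceOf (A ∩ B) B) :
    StrictlyBelow A B := by
  obtain ⟨x, y₁, y₂, ⟨hy₁A, hy₁B⟩, ⟨hy₂B, hy₂A⟩, hlt⟩ := h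
  have hne : A ≠ B := by
    rintro rfl
    exact hy₁B hy₁A
  refine (hA.lineSeparated hB h₁ h₂ hne).strictlyBelow hy₁A hy₂B hlt fun a b ha hb => ?_
  by_contra! hba
  have hb₁ : y₁ ≤ b := by
    by_contra! h
    exact hy₁B (hB.convex.slice_mem hb hy₂B h.le hlt.le)
  have ha₂ : a ≤ y₂ := by
    by_contra! h
    exact hy₂A (hA.convex.slice_mem hy₁A ha hlt.le h.le)
  have haB := hB.convex.slice_mem hb hy₂B hba.le ha₂
  have hbA := hA.convex.slice_mem hy₁A ha hb₁ hba.le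
  exact hy₁B (h₁.slice_mem ⟨ha, haB⟩ ⟨hbA, hb⟩ hba.ne' hy₁A).2

/-- There is no cyclic chain `Δ₀ ≺ Δ₁ ≺ ⋯ ≺ Δ_{t-1} ≺ Δ₀` of triangles in `ℝ²`
such that the intersection of any two of them is a common face of both. -/
theorem no_cyclic_chain :
    ¬ ∃ (t : ℕ) (Δ : ZMod t → Set (ℝ × ℝ)), 1 ≤ t ∧
      (∀ i, IsTriangle (Δ i)) ∧
      (∀ i j, i ≠ j → IsFaceOf (Δ i ∩ Δ j) (Δ i) ∧ IsFaceOf (Δ i ∩ Δ j) (Δ j)) ∧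
      (∀ i, LiesAbove (Δ i) (Δ (i + 1))) := by
  classical
  rintro ⟨t, Δ, ht, htri, hface, habove⟩
  have : NeZero t := ⟨by omega⟩
  obtain ⟨A, hA, hmax⟩ := exists_not_strictlyBelow (Finset.univ.image Δ)
    (Finset.univ_nonempty.image Δ)
    (by simpa using fun i => (htri i).convex)
    (by simpa using fun i => (htri i).isCompact)
    (by simpa using fun i => (htri i).interior_nonempty)
    (by
      simp only [Finset.mem_image, Finset.mem_univ, true_and]
      rintro _ ⟨i, rfl⟩ _ ⟨j, rfl⟩ hne
      have hf := hface i j (fun h => hne (congrArg Δ h))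
      exact (htri i).lineSeparated (htri j) hf.1 hf.2 hne)
  obtain ⟨i, -, rfl⟩ := Finset.mem_image.1 hA
  have hne : i ≠ i + 1 := by
    intro h
    obtain ⟨x, y, -, ⟨hy, hy'⟩, -⟩ := habove i
    exact hy' (h ▸ hy)
  have hf := hface i (i + 1) hne
  exact hmax _ (Finset.mem_image_of_mem Δ (Finset.mem_univ _))
    ((habove i).strictlyBelow (htri i) (htri (i + 1)) hf.1 hf.2)
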